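/- arXiv:1712.07948 — 2 statements merged into one kernel-verified Lean document; each statement's English description precedes it below -/
import Mathlib

section
/- For every i = 1,2,3, the kernel N_i satisfies N_i(x,y) = 0 for all y ∈ Ω and all x ∈ ℝ³ ∖ Ω. -/
open MeasureTheory Metric Set Filter Real

noncomputable section

/-- Euclidean three-space. -/
abbrev E3 := EuclideanSpace ℝ (Fin 3)

/-- The totally antisymmetric Ricci (Levi-Civita) symbol `ε_{ijk}` on `Fin 3`. -/
def ricci (i j k : Fin 3) : ℝ :=
  ((j.1 : ℝ) - (i.1 : ℝ)) * ((k.1 : ℝ) - (i.1 : ℝ)) * ((k.1 : ℝ) - (j.1 : ℝ)) / 2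

/-- The kernel `N_i(x,y) = (x-y)_i ∫₁^∞ ψ(y+α(x-y)) α(α-1) dα`. -/
def Nker (ψ : E3 → ℝ) (i : Fin 3) (x y : E3) : ℝ :=
  (x - y) i * ∫ α in Ioi (1 : ℝ), ψ (y + α • (x - y)) * (α * (α - 1))

/-- The partial derivative `∂_{x_m} N_i(x,y)` of the kernel in the `m`-th coordinate
of the first argument. -/
def Ndx (ψ : E3 → ℝ) (i m : Fin 3) (x y : E3) : ℝ :=
  lineDeriv ℝ (fun x' => Nker ψ i x' y) x (EuclideanSpace.single m 1)

/-- The operator `(Rg)^k(x) = -ε_{ijk} ∫_Ω g^j(y) N_i(x,y) dy` (summation over `i,j`). -/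
def Rop (ψ : E3 → ℝ) (Ω : Set E3) (g : Fin 3 → E3 → ℝ) (k : Fin 3) (x : E3) : ℝ :=
  -∑ i, ∑ j, ricci i j k * ∫ y in Ω, g j y * Nker ψ i x y

/-- The regularized operator `(R^ε g)^k(x)`. -/
def Reps (ψ : E3 → ℝ) (η : ℝ → ℝ) (Ω : Set E3) (g : Fin 3 → E3 → ℝ) (ε : ℝ)
    (k : Fin 3) (x : E3) : ℝ :=
  -∑ i, ∑ j, ricci i j k *
    ∫ y in Ω, (x - y) i * g j y *
      ((∫ α in Ioi (1 : ℝ), ψ (y + α • (x - y)) * (α * (α - 1))) * η (‖x - y‖ / ε))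

/-- The Bogovskiĭ operator `(BF)^i(x) = ∫_Ω F(y) Ñ_i(x,y) dy`. -/
def Bop (ψ : E3 → ℝ) (Ω : Set E3) (F : E3 → ℝ) (i : Fin 3) (x : E3) : ℝ :=
  ∫ y in Ω, F y * ((x - y) i * ∫ α in Ioi (1 : ℝ), ψ (y + α • (x - y)) * α ^ 2)

/-- `(curl v)^i(x) = ε_{ijk} ∂_{x_j} v^k(x)` (summation over `j,k`). -/
def curlOp (v : Fin 3 → E3 → ℝ) (i : Fin 3) (x : E3) : ℝ :=
  ∑ j, ∑ k, ricci i j k * lineDeriv ℝ (v k) x (EuclideanSpace.single j 1)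

/-- The modulus of continuity `ω(f,ρ)` of `f` over `closure Ω`. -/
def modulus (Ω : Set E3) (f : E3 → ℝ) (ρ : ℝ) : ℝ :=
  sSup {d : ℝ | ∃ x ∈ closure Ω, ∃ y ∈ closure Ω, dist x y ≤ ρ ∧ d = |f x - f y|}

/-- `f` is Dini continuous on `Ω`: continuous on `closure Ω` with
`∫₀^{diam Ω} ω(f,ρ)/ρ dρ < ∞`. -/
def DiniCont (Ω : Set E3) (f : E3 → ℝ) : Prop :=
  ContinuousOn f (closure Ω) ∧
    IntegrableOn (fun ρ => modulus Ω f ρ / ρ) (Ioc 0 (diam Ω))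

/-- The candidate derivative `v_m^k` from the main regularity theorem. -/
def vmk (ψ : E3 → ℝ) (Ω : Set E3) (g : Fin 3 → E3 → ℝ) (R : ℝ) (k m : Fin 3) (x : E3) : ℝ :=
  -∑ i, ∑ j, ricci i j k *
    ((∫ y in ball (0 : E3) R, (g j y - g j x) * Ndx ψ i m x y)
      + g j x * (∫ y in ball (0 : E3) R, (x - y) i *
          ∫ α in Ioi (1 : ℝ), lineDeriv ℝ ψ (y + α • (x - y)) (EuclideanSpace.single m 1)
            * (α * (α - 1)))
      - g j x * (R ^ 2 *
          ∫ u : sphere (0 : E3) 1, Nker ψ i x (R • (u : E3)) * (u : E3) m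
            ∂(volume : Measure E3).toSphere))

/-- the kernel `N_i(x,y)` vanishes for `y ∈ Ω` and `x ∉ Ω`. -/
theorem Nker_vanishes_outside
    (Ω : Set E3) (hΩo : IsOpen Ω) (hΩb : Bornology.IsBounded Ω)
    (hstar : ∀ c ∈ closedBall (0 : E3) 1, StarConvex ℝ c Ω)
    (ψ : E3 → ℝ) (hψs : ContDiff ℝ (⊤ : ℕ∞) ψ) (hψsupp : tsupport ψ ⊆ ball (0 : E3) 1)
    (hψint : ∫ y, ψ y = 1) :
    ∀ (i : Fin 3), ∀ y ∈ Ω, ∀ x ∉ Ω, Nker ψ i x y = 0 := by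
  intro i y hy x hx
  refine mul_eq_zero_of_right _ (setIntegral_eq_zero_of_forall_eq_zero fun α hα => ?_)
  refine mul_eq_zero_of_left (by_contra fun hψ => hx ?_) _
  have hα1 : 1 < α := hα
  have hα0 : 0 < α := one_pos.trans hα1
  set c := y + α • (x - y) with hc_def
  have hc : c ∈ closedBall (0 : E3) 1 :=
    ball_subset_closedBall (hψsupp (subset_tsupport ψ hψ))
  have hmem := hstar c hc hy (inv_nonneg.2 hα0.le) (sub_nonneg.2 (inv_le_one_of_one_le₀ hα1.le))
    (add_sub_cancel _ _)
  have hx_eq : α⁻¹ • c + (1 - α⁻¹) • y = x := by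
    rw [hc_def, smul_add, inv_smul_smul₀ hα0.ne', sub_smul, one_smul]
    abel
  exact hx_eq ▸ hmem

end
end

section
/- If g ∈ (C₀^∞(Ω))³, i.e. g is smooth with compact support contained in Ω, then Rg ∈ (C₀^∞(Ω))³: Rg is smooth on ℝ³ and its support is a compact subset of Ω. -/
open MeasureTheory Metric Set Filter Real

noncomputable section

/-- A smooth cutoff on the line, equal to `1` on `[-1, 1]` and supported in `[-2, 2]`. -/
def timeCutoff : ContDiffBump (0 : ℝ) where
  rIn := 1
  rOut := 2
  rIn_pos := one_pos
  rIn_lt_rOut := one_lt_two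

/-- The kernel `f(x - tw) ψ(x + (1-t)w) w_i (1-t)`, cut off in `t`, obtained from `f(y) N_i(x,y)`
by the substitution `t = 1/α`, `y = x - tw`. -/
def joinKernel (f ψ : E3 → ℝ) (i : Fin 3) (x : E3) (p : ℝ × E3) : ℝ :=
  timeCutoff p.1 * (f (x - p.1 • p.2) * ψ (x + (1 - p.1) • p.2) * (p.2 i * (1 - p.1)))

theorem contDiff_parametric_integral {P G : Type*} [NormedAddCommGroup P] [NormedSpace ℝ P]
    [NormedAddCommGroup G] [NormedSpace ℝ G] [MeasurableSpace G] [BorelSpace G]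
    (μ : Measure G) [IsLocallyFiniteMeasure μ] {F : P → G → ℝ} {n : ℕ∞}
    (hF : ContDiff ℝ n (Function.uncurry F))
    (hsupp : ∀ r : ℝ, ∃ k : Set G, IsCompact k ∧ ∀ p ∈ ball (0 : P) r, ∀ x ∉ k, F p x = 0) :
    ContDiff ℝ n (fun p => ∫ x, F p x ∂μ) := by
  rw [contDiff_iff_contDiffAt]
  intro p₀
  obtain ⟨k, hk, hk0⟩ := hsupp (‖p₀‖ + 1)
  have hF' : ContDiff ℝ n (fun q : P × G => F q.1 (-q.2)) :=
    hF.comp (contDiff_fst.prodMk contDiff_snd.neg)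
  have h := contDiffOn_convolution_right_with_param_comp (𝕜 := ℝ) (μ := μ) (n := n)
    (ContinuousLinearMap.mul ℝ ℝ) (s := ball (0 : P) (‖p₀‖ + 1)) (v := fun _ => (0 : G))
    contDiffOn_const (f := fun _ => (1 : ℝ)) (g := fun p x => F p (-x)) (k := -k) isOpen_ball
    hk.neg (fun p x hp hx => hk0 p hp _ (by simpa using hx)) (locallyIntegrable_const 1)
    hF'.contDiffOn
  have h' := h.contDiffAt (isOpen_ball.mem_nhds (by simp : p₀ ∈ ball (0 : P) (‖p₀‖ + 1)))
  simpa [convolution_def] using h'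

theorem joinKernel_contDiff {f ψ : E3 → ℝ} (hf : ContDiff ℝ (⊤ : ℕ∞) f)
    (hψ : ContDiff ℝ (⊤ : ℕ∞) ψ) (i : Fin 3) :
    ContDiff ℝ (⊤ : ℕ∞) (Function.uncurry (joinKernel f ψ i)) := by
  have hχ : ContDiff ℝ (⊤ : ℕ∞) (timeCutoff : ℝ → ℝ) := timeCutoff.contDiff
  have hcoord : ContDiff ℝ (⊤ : ℕ∞) (fun q : E3 × ℝ × E3 => q.2.2 i) :=
    (EuclideanSpace.proj (𝕜 := ℝ) i).contDiff.comp (contDiff_snd.comp contDiff_snd)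
  unfold Function.uncurry joinKernel
  refine (hχ.comp (by fun_prop)).mul (((hf.comp ?_).mul (hψ.comp ?_)).mul (hcoord.mul ?_)) <;>
    fun_prop

theorem joinKernel_eq_zero {f ψ : E3 → ℝ} {M : ℝ} (hf : ∀ y, M < ‖y‖ → f y = 0)
    (hψ : ∀ y, M < ‖y‖ → ψ y = 0) (i : Fin 3) {r : ℝ} {x : E3} (hx : ‖x‖ ≤ r) {p : ℝ × E3}
    (hp : p ∉ closedBall (0 : ℝ) 2 ×ˢ closedBall (0 : E3) (2 * (r + M))) :
    joinKernel f ψ i x p = 0 := by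
  obtain ⟨t, w⟩ := p
  unfold joinKernel
  by_cases ht : t ∈ closedBall (0 : ℝ) 2
  · have hw : 2 * (r + M) < ‖w‖ := by
      by_contra! h
      exact hp ⟨ht, by simpa using h⟩
    rcases le_total (1 / 2) |t| with h | h
    · rw [hf]
      · simp
      · have h1 : ‖t • w‖ ≤ ‖x‖ + ‖x - t • w‖ := by
          simpa using norm_sub_le x (x - t • w)
        rw [norm_smul, Real.norm_eq_abs] at h1
        nlinarith [norm_nonneg w]
    · rw [hψ]
      · simp
      · have h1 : ‖(1 - t) • w‖ ≤ ‖x + (1 - t) • w‖ + ‖x‖ := by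
          simpa using norm_sub_le (x + (1 - t) • w) x
        have h2 : 1 / 2 ≤ |1 - t| := by
          have := abs_le.1 h
          rw [abs_of_nonneg] <;> linarith
        rw [norm_smul, Real.norm_eq_abs] at h1
        nlinarith [norm_nonneg w]
  · rw [timeCutoff.zero_of_le_dist, zero_mul]
    have : ¬ dist t 0 ≤ 2 := ht
    exact (not_le.1 this).le

theorem exists_norm_bound_of_hasCompactSupport {f ψ : E3 → ℝ} (hf : HasCompactSupport f)
    (hψ : HasCompactSupport ψ) :
    ∃ M : ℝ, (∀ y, M < ‖y‖ → f y = 0) ∧ ∀ y, M < ‖y‖ → ψ y = 0 := by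
  obtain ⟨M, hM⟩ := (hf.isCompact.union hψ.isCompact).isBounded.exists_norm_le
  refine ⟨M, fun y hy => ?_, fun y hy => ?_⟩
  · exact image_eq_zero_of_notMem_tsupport fun h => (hM y (Or.inl h)).not_gt hy
  · exact image_eq_zero_of_notMem_tsupport fun h => (hM y (Or.inr h)).not_gt hy

theorem joinKernel_integrable {f ψ : E3 → ℝ} (hf : ContDiff ℝ (⊤ : ℕ∞) f)
    (hψ : ContDiff ℝ (⊤ : ℕ∞) ψ) (hfc : HasCompactSupport f) (hψc : HasCompactSupport ψ)
    (i : Fin 3) (x : E3) (μ : Measure (ℝ × E3)) [IsFiniteMeasureOnCompacts μ] :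
    Integrable (joinKernel f ψ i x) μ := by
  obtain ⟨M, hM, hM'⟩ := exists_norm_bound_of_hasCompactSupport hfc hψc
  have hc : Continuous (joinKernel f ψ i x) :=
    (joinKernel_contDiff hf hψ i).continuous.comp (Continuous.prodMk_right x)
  exact hc.integrable_of_hasCompactSupport (HasCompactSupport.intro
    ((isCompact_closedBall _ _).prod (isCompact_closedBall _ _))
    fun p hp => joinKernel_eq_zero hM hM' i le_rfl hp)

theorem integral_Ioi_one_eq (h : ℝ → ℝ) :
    ∫ α in Ioi (1 : ℝ), h α = ∫ t in Ioo (0 : ℝ) 1, (t ^ 2)⁻¹ * h t⁻¹ := by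
  have himg : (fun t : ℝ => t⁻¹) '' Ioo 0 1 = Ioi 1 := by
    ext a
    constructor
    · rintro ⟨t, ht, rfl⟩
      exact (one_lt_inv₀ ht.1).2 ht.2
    · intro ha
      have h0 : (0 : ℝ) < a := one_pos.trans ha
      exact ⟨a⁻¹, ⟨inv_pos.2 h0, inv_lt_one_of_one_lt₀ ha⟩, inv_inv a⟩
  rw [← himg, integral_image_eq_integral_abs_deriv_smul measurableSet_Ioo
    (fun t ht => (hasDerivAt_inv ht.1.ne').hasDerivWithinAt) inv_injective.injOn]
  refine setIntegral_congr_fun measurableSet_Ioo fun t _ => ?_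
  simp [abs_neg, abs_inv]

theorem integral_comp_sub_smul (F : E3 → ℝ) (x : E3) {t : ℝ} (ht : 0 < t) :
    ∫ y, F y = ∫ w, t ^ 3 * F (x - t • w) := by
  rw [integral_const_mul, Measure.integral_comp_smul volume (fun z => F (x - z)) t,
    integral_sub_left_eq_self F volume x, finrank_euclideanSpace_fin, abs_of_pos (by positivity),
    smul_eq_mul, mul_inv_cancel_left₀ (by positivity)]

/-- The integrand in `(y, t)` after the substitution `t = 1/α`. -/
def invKernel (f ψ : E3 → ℝ) (i : Fin 3) (x y : E3) (t : ℝ) : ℝ :=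
  f y * ((x - y) i * ((t ^ 2)⁻¹ * (ψ (y + t⁻¹ • (x - y)) * (t⁻¹ * (t⁻¹ - 1)))))

theorem invKernel_comp (f ψ : E3 → ℝ) (i : Fin 3) (x w : E3) {t : ℝ} (ht : t ∈ Ioo (0 : ℝ) 1) :
    t ^ 3 * invKernel f ψ i x (x - t • w) t = joinKernel f ψ i x (t, w) := by
  have h0 : t ≠ 0 := ht.1.ne'
  have h1 : timeCutoff t = 1 := timeCutoff.one_of_mem_closedBall <| by
    rw [mem_closedBall, Real.dist_eq, sub_zero, abs_of_pos ht.1]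
    exact ht.2.le
  have h2 : x - t • w + t⁻¹ • (x - (x - t • w)) = x + (1 - t) • w := by
    rw [sub_sub_cancel, inv_smul_smul₀ h0]
    module
  unfold invKernel joinKernel
  rw [h1, h2, sub_sub_cancel, PiLp.smul_apply, smul_eq_mul]
  field_simp

theorem invKernel_integrable {f ψ : E3 → ℝ} (hf : ContDiff ℝ (⊤ : ℕ∞) f)
    (hψ : ContDiff ℝ (⊤ : ℕ∞) ψ) (hfc : HasCompactSupport f) (hψc : HasCompactSupport ψ)
    (i : Fin 3) (x : E3) :
    Integrable (Function.uncurry (invKernel f ψ i x))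
      (volume.prod (volume.restrict (Ioo (0 : ℝ) 1))) := by
  have hmeas : Measurable (Function.uncurry (invKernel f ψ i x)) := by
    have := hf.continuous.measurable
    have := hψ.continuous.measurable
    unfold Function.uncurry invKernel
    fun_prop
  have hJ := joinKernel_integrable hf hψ hfc hψc i x ((volume.restrict (Ioo (0 : ℝ) 1)).prod volume)
  have hJs := (integrable_prod_iff hJ.aestronglyMeasurable).1 hJ
  rw [integrable_prod_iff' hmeas.aestronglyMeasurable]
  refine ⟨?_, hJs.2.congr ?_⟩
  · filter_upwards [hJs.1, ae_restrict_mem measurableSet_Ioo] with t hJt ht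
    have h1 : Integrable (fun w => invKernel f ψ i x (x - t • w) t) := by
      refine (hJt.const_mul (t ^ 3)⁻¹).congr (Eventually.of_forall fun w => ?_)
      have h3 : t ^ 3 ≠ 0 := pow_ne_zero _ ht.1.ne'
      simp only [← invKernel_comp f ψ i x w ht, inv_mul_cancel_left₀ h3]
    have h2 := (integrable_comp_smul_iff volume (fun z => invKernel f ψ i x (x - z) t)
      ht.1.ne').1 h1
    exact (integrable_comp_sub_left (fun z => invKernel f ψ i x z t) x).1 h2
  · filter_upwards [ae_restrict_mem measurableSet_Ioo] with t ht
    rw [integral_comp_sub_smul (fun y => ‖Function.uncurry (invKernel f ψ i x) (y, t)‖) x ht.1]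
    refine integral_congr_ae (Eventually.of_forall fun w => ?_)
    have h3 : 0 ≤ t ^ 3 := pow_nonneg ht.1.le _
    simp only [← invKernel_comp f ψ i x w ht, norm_mul, Real.norm_of_nonneg h3,
      Function.uncurry_apply_pair]

theorem integral_mul_Nker_eq {f ψ : E3 → ℝ} (hf : ContDiff ℝ (⊤ : ℕ∞) f)
    (hψ : ContDiff ℝ (⊤ : ℕ∞) ψ) (hfc : HasCompactSupport f) (hψc : HasCompactSupport ψ)
    (i : Fin 3) (x : E3) :
    ∫ y, f y * Nker ψ i x y =
      ∫ p, joinKernel f ψ i x p ∂((volume.restrict (Ioo (0 : ℝ) 1)).prod volume) := by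
  rw [integral_prod _ (joinKernel_integrable hf hψ hfc hψc i x _)]
  calc ∫ y, f y * Nker ψ i x y = ∫ y, ∫ t in Ioo (0 : ℝ) 1, invKernel f ψ i x y t := by
        simp only [Nker, integral_Ioi_one_eq, invKernel, integral_const_mul]
    _ = ∫ t in Ioo (0 : ℝ) 1, ∫ y, invKernel f ψ i x y t :=
        integral_integral_swap (invKernel_integrable hf hψ hfc hψc i x)
    _ = _ := by
        refine setIntegral_congr_fun measurableSet_Ioo fun t ht => ?_
        simp only [integral_comp_sub_smul (fun y => invKernel f ψ i x y t) x ht.1,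
          invKernel_comp f ψ i x _ ht]

theorem integral_mul_Nker_contDiff {f ψ : E3 → ℝ} (hf : ContDiff ℝ (⊤ : ℕ∞) f)
    (hψ : ContDiff ℝ (⊤ : ℕ∞) ψ) (hfc : HasCompactSupport f) (hψc : HasCompactSupport ψ)
    (i : Fin 3) : ContDiff ℝ (⊤ : ℕ∞) (fun x => ∫ y, f y * Nker ψ i x y) := by
  obtain ⟨M, hM, hM'⟩ := exists_norm_bound_of_hasCompactSupport hfc hψc
  simp only [integral_mul_Nker_eq hf hψ hfc hψc]
  refine contDiff_parametric_integral _ (joinKernel_contDiff hf hψ i) fun r =>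
    ⟨_, (isCompact_closedBall (0 : ℝ) 2).prod (isCompact_closedBall (0 : E3) (2 * (r + M))),
      fun x hx p hp => joinKernel_eq_zero hM hM' i (mem_ball_zero_iff.1 hx).le hp⟩

/-- The union of all segments joining a point of `A` to a point of `B`. -/
def segmentJoin (A B : Set E3) : Set E3 :=
  (fun q : ℝ × E3 × E3 => (1 - q.1) • q.2.1 + q.1 • q.2.2) '' (Icc 0 1 ×ˢ A ×ˢ B)

theorem segmentJoin_isCompact {A B : Set E3} (hA : IsCompact A) (hB : IsCompact B) :
    IsCompact (segmentJoin A B) :=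
  (isCompact_Icc.prod (hA.prod hB)).image (by fun_prop)

theorem integral_mul_Nker_eq_zero {f ψ : E3 → ℝ} (i : Fin 3) {x : E3}
    (hx : x ∉ segmentJoin (tsupport f) (tsupport ψ)) : ∫ y, f y * Nker ψ i x y = 0 := by
  refine integral_eq_zero_of_ae (Eventually.of_forall fun y => ?_)
  by_cases hy : y ∈ tsupport f
  · have h : ∫ α in Ioi (1 : ℝ), ψ (y + α • (x - y)) * (α * (α - 1)) = 0 := by
      refine setIntegral_eq_zero_of_forall_eq_zero fun α hα => ?_
      have h1 : (1 : ℝ) < α := hα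
      have h0 : (0 : ℝ) < α := one_pos.trans h1
      rw [image_eq_zero_of_notMem_tsupport (f := ψ), zero_mul]
      intro hmem
      refine hx ⟨(α⁻¹, y, y + α • (x - y)),
        ⟨⟨inv_nonneg.2 h0.le, inv_le_one_of_one_le₀ h1.le⟩, hy, hmem⟩, ?_⟩
      simp only [smul_add, inv_smul_smul₀ h0.ne']
      module
    simp [Nker, h]
  · simp [image_eq_zero_of_notMem_tsupport hy]

/-- if `g ∈ (C₀^∞(Ω))³` then `Rg ∈ (C₀^∞(Ω))³`. -/
theorem Rop_smooth_compact_support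
    (Ω : Set E3) (hΩo : IsOpen Ω) (hΩb : Bornology.IsBounded Ω)
    (hstar : ∀ c ∈ closedBall (0 : E3) 1, StarConvex ℝ c Ω)
    (ψ : E3 → ℝ) (hψs : ContDiff ℝ (⊤ : ℕ∞) ψ) (hψsupp : tsupport ψ ⊆ ball (0 : E3) 1)
    (hψint : ∫ y, ψ y = 1)
    (g : Fin 3 → E3 → ℝ)
    (hgs : ∀ j, ContDiff ℝ (⊤ : ℕ∞) (g j))
    (hgc : ∀ j, HasCompactSupport (g j))
    (hgsupp : ∀ j, tsupport (g j) ⊆ Ω) :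
    ∀ k, ContDiff ℝ (⊤ : ℕ∞) (Rop ψ Ω g k) ∧ HasCompactSupport (Rop ψ Ω g k) ∧
      tsupport (Rop ψ Ω g k) ⊆ Ω := by
  have hψc : HasCompactSupport ψ :=
    (isCompact_closedBall (0 : E3) 1).of_isClosed_subset (isClosed_tsupport ψ)
      (hψsupp.trans ball_subset_closedBall)
  have hΩ : ∀ i j x, ∫ y in Ω, g j y * Nker ψ i x y = ∫ y, g j y * Nker ψ i x y := by
    intro i j x
    refine setIntegral_eq_integral_of_forall_compl_eq_zero fun y hy => ?_
    rw [image_eq_zero_of_notMem_tsupport fun h => hy (hgsupp j h), zero_mul]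
  intro k
  set K : Set E3 := ⋃ j, segmentJoin (tsupport (g j)) (tsupport ψ)
  have hKc : IsCompact K := isCompact_iUnion fun j => segmentJoin_isCompact (hgc j) hψc
  have hKΩ : K ⊆ Ω := by
    refine iUnion_subset fun j => ?_
    rintro _ ⟨⟨t, y, p⟩, ⟨ht, hy, hp⟩, rfl⟩
    have h := hstar p (ball_subset_closedBall (hψsupp hp)) (hgsupp j hy) ht.1
      (sub_nonneg.2 ht.2) (add_sub_cancel t 1)
    rwa [add_comm] at h
  have hzero : ∀ x ∉ K, Rop ψ Ω g k x = 0 := by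
    intro x hx
    have h : ∀ i j, ∫ y, g j y * Nker ψ i x y = 0 := fun i j =>
      integral_mul_Nker_eq_zero i fun hxj => hx (mem_iUnion.2 ⟨j, hxj⟩)
    simp [Rop, hΩ, h]
  refine ⟨?_, HasCompactSupport.intro hKc hzero, ?_⟩
  · unfold Rop
    simp only [hΩ]
    exact (ContDiff.sum fun i _ => ContDiff.sum fun j _ =>
      contDiff_const.mul (integral_mul_Nker_contDiff (hgs j) hψs (hgc j) hψc i)).neg
  · refine (closure_minimal (fun x hx => ?_) hKc.isClosed).trans hKΩ
    by_contra h
    exact hx (hzero x h)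

end
end
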